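/- Let X be a finite metric space with n = 2k+2 points (k ≥ 0 an integer). If t_b(X) < t_d(X), then for all r with t_b(X) ≤ r < t_d(X) the reduced homology H̃_k(VR_r(X); F) is isomorphic to F, and for all r < t_b(X) or r ≥ t_d(X) it vanishes. If t_b(X) ≥ t_d(X), then H̃_k(VR_r(X); F) = 0 for all r. -/

import Mathlib

/-- The largest distance from `x` to any point of `X`. -/
noncomputable def ptTd (X : Type*) [MetricSpace X] (x : X) : ℝ :=
  sSup (Set.range fun y => dist x y)

/-- The second largest distance (counted with multiplicity over points) from `x`
to points of `X`. -/
noncomputable def ptTb (X : Type*) [MetricSpace X] (x : X) : ℝ :=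
  sSup {r : ℝ | ∃ y z : X, y ≠ z ∧ r = min (dist x y) (dist x z)}

/-- `t_b(X) = max_{x ∈ X} t_b(x)`. -/
noncomputable def tbX (X : Type*) [MetricSpace X] : ℝ :=
  sSup (Set.range (ptTb X))

/-- `t_d(X) = min_{x ∈ X} t_d(x)`. -/
noncomputable def tdX (X : Type*) [MetricSpace X] : ℝ :=
  sInf (Set.range (ptTd X))

/-- An ordered `(m-1)`-dimensional simplex (an `m`-tuple of vertices, repetitions
allowed) of the Vietoris–Rips complex of `X` at scale `r`: a tuple whose pairwise
distances are all `≤ r`.  For `m = 0` this is the unique "empty simplex", giving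
the augmentation in reduced homology. -/
def VRSimplex (X : Type*) [MetricSpace X] (r : ℝ) (m : ℕ) : Type _ :=
  {f : Fin m → X // ∀ i j, dist (f i) (f j) ≤ r}

/-- The augmented simplicial chain complex of the Vietoris–Rips complex of `X` at
scale `r` with coefficients in `F`: `VRChain F X r m` is the free `F`-module on the
`m`-tuples spanning a simplex, so that the reduced homology `H̃_k(VR_r(X); F)` is the
homology of `VRChain F X r (k+2) → VRChain F X r (k+1) → VRChain F X r k`. -/
abbrev VRChain (F : Type*) [Field F] (X : Type*) [MetricSpace X] (r : ℝ) (m : ℕ) :=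
  VRSimplex X r m →₀ F

/-- The `i`-th face of a simplex. -/
def VRface {X : Type*} [MetricSpace X] {r : ℝ} {m : ℕ}
    (f : VRSimplex X r (m + 1)) (i : Fin (m + 1)) : VRSimplex X r m :=
  ⟨fun j => f.1 (i.succAbove j), fun _ _ => f.2 _ _⟩

/-- The simplicial boundary map `∂ = Σᵢ (-1)ⁱ (i-th face)`; in lowest degree it is
the augmentation map. -/
noncomputable def VRboundary (F : Type*) [Field F] (X : Type*) [MetricSpace X]
    (r : ℝ) (m : ℕ) : VRChain F X r (m + 1) →ₗ[F] VRChain F X r m :=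
  Finsupp.lsum F fun f => LinearMap.toSpanSingleton F _
    (∑ i : Fin (m + 1), ((-1 : F) ^ (i : ℕ)) • Finsupp.single (VRface f i) 1)

/-! ### Ordered chains on lists -/

section ListChains

open Finsupp

variable {F : Type*} [Field F] {X : Type*}

/-- The operator on chains of lists that prepends `v` to every list. -/
noncomputable def listCone (F : Type*) [Field F] {X : Type*} (v : X) :
    (List X →₀ F) →ₗ[F] (List X →₀ F) :=
  Finsupp.lmapDomain F F (List.cons v)

@[simp]
lemma listCone_single (v : X) (l : List X) (a : F) :
    listCone F v (single l a) = single (v :: l) a := by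
  simp [listCone]

/-- The alternating sum of the faces of a list of vertices. -/
noncomputable def listFaces (F : Type*) [Field F] {X : Type*} : List X → (List X →₀ F)
  | [] => 0
  | x :: l => single l 1 - listCone F x (listFaces F l)

/-- The boundary map on chains of lists; it vanishes on the empty list. -/
noncomputable def listBoundary (F : Type*) [Field F] (X : Type*) :
    (List X →₀ F) →ₗ[F] (List X →₀ F) :=
  Finsupp.linearCombination F (listFaces F)

lemma listBoundary_single (l : List X) (a : F) :
    listBoundary F X (single l a) = a • listFaces F l := by
  simp [listBoundary]

lemma listBoundary_listCone (v : X) (c : List X →₀ F) :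
    listBoundary F X (listCone F v c) = c - listCone F v (listBoundary F X c) := by
  induction c using Finsupp.induction_linear with
  | zero => simp
  | add f g hf hg => simp only [map_add, hf, hg]; abel
  | single l a => simp [listBoundary_single, listFaces, smul_sub]

lemma listBoundary_listFaces (l : List X) : listBoundary F X (listFaces F l) = 0 := by
  induction l with
  | nil => simp [listFaces]
  | cons x l ih =>
    simp [listFaces, listBoundary_listCone, ih, listBoundary_single]

lemma listBoundary_listBoundary (c : List X →₀ F) :
    listBoundary F X (listBoundary F X c) = 0 := by
  induction c using Finsupp.induction_linear with
  | zero => simp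
  | add f g hf hg => simp [hf, hg]
  | single l a => simp [listBoundary_single, listBoundary_listFaces]

lemma listFaces_mem_supported (l : List X) :
    listFaces F l ∈ Finsupp.supported F F {l' : List X | l'.length + 1 = l.length ∧ l' ⊆ l} := by
  induction l with
  | nil => simp [listFaces]
  | cons x l ih =>
    refine Submodule.sub_mem _ (Finsupp.single_mem_supported F 1 (by simp)) ?_
    have h : listCone F x (listFaces F l) ∈ (Finsupp.supported F F
        {l' : List X | l'.length + 1 = l.length ∧ l' ⊆ l}).map (listCone F x) :=
      Submodule.mem_map_of_mem ih
    rw [listCone, Finsupp.lmapDomain_supported] at h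
    refine Finsupp.supported_mono ?_ h
    rintro _ ⟨l', ⟨h1, h2⟩, rfl⟩
    refine ⟨by simp [h1], List.cons_subset_cons x h2⟩

end ListChains

/-! ### The flag complex of a relation -/

section FlagChains

open Finsupp

variable {F : Type*} [Field F] {X : Type*} {R : X → X → Prop} {S A B : Finset X} {m : ℕ}

/-- The `m`-tuples of pairwise related elements of `S`. -/
def flagTuples (R : X → X → Prop) (S : Finset X) (m : ℕ) : Set (List X) :=
  {l | l.length = m ∧ (∀ x ∈ l, x ∈ S) ∧ ∀ x ∈ l, ∀ y ∈ l, R x y}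

/-- The chains on the `m`-tuples of pairwise related elements of `S`. -/
noncomputable def flagChains (F : Type*) [Field F] {X : Type*} (R : X → X → Prop)
    (S : Finset X) (m : ℕ) : Submodule F (List X →₀ F) :=
  Finsupp.supported F F (flagTuples R S m)

lemma flagChains_mono (h : A ⊆ B) : flagChains F R A m ≤ flagChains F R B m :=
  Finsupp.supported_mono fun _ hl => ⟨hl.1, fun x hx => h (hl.2.1 x hx), hl.2.2⟩

lemma mem_flagChains_inter [DecidableEq X] {c : List X →₀ F} (hA : c ∈ flagChains F R A m)
    (hB : c ∈ flagChains F R B m) : c ∈ flagChains F R (A ∩ B) m := by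
  intro l hl
  have h1 := hA hl
  have h2 := hB hl
  exact ⟨h1.1, fun x hx => Finset.mem_inter.2 ⟨h1.2.1 x hx, h2.2.1 x hx⟩, h1.2.2⟩

lemma listBoundary_mem_flagChains {c : List X →₀ F} (hc : c ∈ flagChains F R S (m + 1)) :
    listBoundary F X c ∈ flagChains F R S m := by
  rw [listBoundary, Finsupp.linearCombination_apply]
  refine Submodule.sum_mem _ fun l hl => Submodule.smul_mem _ _ ?_
  obtain ⟨h1, h2, h3⟩ := hc hl
  refine Finsupp.supported_mono ?_ (listFaces_mem_supported (F := F) l)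
  rintro l' ⟨h4, h5⟩
  exact ⟨by omega, fun x hx => h2 x (h5 hx), fun x hx y hy => h3 x (h5 hx) y (h5 hy)⟩

lemma listCone_mem_flagChains (hsymm : ∀ x y, R x y → R y x) {v : X} (hv : v ∈ S)
    (hvS : ∀ x ∈ S, R v x) {c : List X →₀ F} (hc : c ∈ flagChains F R S m) :
    listCone F v c ∈ flagChains F R S (m + 1) := by
  have h : listCone F v c ∈ (flagChains F R S m).map (listCone F v) :=
    Submodule.mem_map_of_mem hc
  rw [listCone, flagChains, Finsupp.lmapDomain_supported] at h
  refine Finsupp.supported_mono ?_ h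
  rintro _ ⟨l, ⟨h1, h2, h3⟩, rfl⟩
  refine ⟨by simp [h1], ?_, ?_⟩
  · simpa using ⟨hv, h2⟩
  · simp only [List.mem_cons]
    rintro x (rfl | hx) y (rfl | hy)
    · exact hvS _ hv
    · exact hvS _ (h2 _ hy)
    · exact hsymm _ _ (hvS _ (h2 _ hx))
    · exact h3 x hx y hy

/-- Every chain is a sum of a chain in the star of `v` and a chain avoiding `v`. -/
lemma exists_flagChains_add_eq [DecidableEq X] [DecidableRel R] (v : X) {c : List X →₀ F}
    (hc : c ∈ flagChains F R S m) :
    ∃ c₁ ∈ flagChains F R (S.filter (R v)) m, ∃ c₂ ∈ flagChains F R (S.erase v) m,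
      c₁ + c₂ = c := by
  classical
  have h : c ∈ flagChains F R (S.filter (R v)) m ⊔ flagChains F R (S.erase v) m := by
    rw [flagChains, flagChains, ← Finsupp.supported_union]
    refine Finsupp.supported_mono ?_ hc
    rintro l ⟨h1, h2, h3⟩
    by_cases hv : v ∈ l
    · exact Or.inl ⟨h1, fun x hx => Finset.mem_filter.2 ⟨h2 x hx, h3 v hv x hx⟩, h3⟩
    · refine Or.inr ⟨h1, fun x hx => Finset.mem_erase.2 ⟨?_, h2 x hx⟩, h3⟩
      rintro rfl
      exact hv hx
  obtain ⟨c₁, h₁, c₂, h₂, h⟩ := Submodule.mem_sup.1 h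
  exact ⟨c₁, h₁, c₂, h₂, h⟩

/-- Every cycle on `m`-tuples of pairwise related elements of `S` is a boundary. -/
def FlagExact (F : Type*) [Field F] {X : Type*} (R : X → X → Prop)
    (S : Finset X) (m : ℕ) : Prop :=
  ∀ c ∈ flagChains F R S m, listBoundary F X c = 0 →
    ∃ d ∈ flagChains F R S (m + 1), listBoundary F X d = c

lemma flagExact_of_cone (hsymm : ∀ x y, R x y → R y x) {v : X} (hv : v ∈ S)
    (hvS : ∀ x ∈ S, R v x) (m : ℕ) : FlagExact F R S m := fun c hc h0 =>
  ⟨listCone F v c, listCone_mem_flagChains hsymm hv hvS hc, by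
    simp [listBoundary_listCone, h0]⟩

lemma flagTuples_empty_succ (m : ℕ) : flagTuples R ∅ (m + 1) = ∅ := by
  refine Set.eq_empty_of_forall_notMem fun l hl => ?_
  obtain ⟨x, hx⟩ := List.exists_mem_of_length_eq_add_one hl.1
  exact absurd (hl.2.1 x hx) (Finset.notMem_empty x)

lemma flagExact_empty (m : ℕ) : FlagExact F R ∅ (m + 1) := by
  intro c hc _
  refine ⟨0, Submodule.zero_mem _, ?_⟩
  rw [flagChains, flagTuples_empty_succ, Finsupp.supported_empty, Submodule.mem_bot] at hc
  simp [hc]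

lemma flagExact_of_erase [DecidableEq X] [DecidableRel R] (hrefl : ∀ x, R x x)
    (hsymm : ∀ x y, R x y → R y x) {v : X} (hv : v ∈ S)
    (h₁ : FlagExact F R (S.erase v) (m + 1))
    (h₂ : FlagExact F R (S.filter (R v) ∩ S.erase v) m) : FlagExact F R S (m + 1) := by
  intro c hc h0
  obtain ⟨c₁, hc₁, c₂, hc₂, rfl⟩ := exists_flagChains_add_eq (R := R) v hc
  rw [map_add] at h0
  have hb : listBoundary F X c₁ ∈ flagChains F R (S.filter (R v) ∩ S.erase v) m := by
    refine mem_flagChains_inter (listBoundary_mem_flagChains hc₁) ?_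
    rw [eq_neg_of_add_eq_zero_left h0]
    exact Submodule.neg_mem _ (listBoundary_mem_flagChains hc₂)
  obtain ⟨d, hd, hdb⟩ := h₂ _ hb (listBoundary_listBoundary _)
  obtain ⟨e₁, he₁, heq₁⟩ := flagExact_of_cone (F := F) hsymm (v := v) (S := S.filter (R v))
    (by simp [hv, hrefl]) (by simp) (m + 1) (c₁ - d)
    (Submodule.sub_mem _ hc₁ (flagChains_mono Finset.inter_subset_left hd)) (by simp [hdb])
  obtain ⟨e₂, he₂, heq₂⟩ := h₁ (c₂ + d)
    (Submodule.add_mem _ hc₂ (flagChains_mono Finset.inter_subset_right hd))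
    (by rw [map_add, hdb, add_comm, h0])
  refine ⟨e₁ + e₂, Submodule.add_mem _ (flagChains_mono (Finset.filter_subset _ _) he₁)
    (flagChains_mono (Finset.erase_subset _ _) he₂), ?_⟩
  rw [map_add, heq₁, heq₂]
  abel

lemma flagExact_of_card_lt [DecidableEq X] [DecidableRel R] (hrefl : ∀ x, R x x)
    (hsymm : ∀ x y, R x y → R y x) (m : ℕ) (S : Finset X) (hS : S.card < 2 * m) :
    FlagExact F R S m := by
  induction h : S.card using Nat.strong_induction_on generalizing S m with
  | _ n ih =>
    subst h
    obtain _ | m := m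
    · omega
    obtain rfl | ⟨v, hv⟩ := S.eq_empty_or_nonempty
    · exact flagExact_empty m
    by_cases hcone : ∀ x ∈ S, R v x
    · exact flagExact_of_cone hsymm hv hcone _
    push Not at hcone
    obtain ⟨w, hw, hvw⟩ := hcone
    have hne : w ≠ v := by
      rintro rfl
      exact hvw (hrefl _)
    have h1 : (S.erase v).card + 1 = S.card := Finset.card_erase_add_one hv
    have h2 : ((S.erase v).erase w).card + 1 = (S.erase v).card :=
      Finset.card_erase_add_one (by simp [hw, hne])
    have h3 : (S.filter (R v) ∩ S.erase v).card ≤ ((S.erase v).erase w).card := by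
      refine Finset.card_le_card fun x hx => ?_
      simp only [Finset.mem_inter, Finset.mem_filter, Finset.mem_erase] at hx ⊢
      refine ⟨?_, hx.2⟩
      rintro rfl
      exact hvw hx.1.2
    exact flagExact_of_erase hrefl hsymm hv
      (ih _ (by omega) (m + 1) _ (by omega) rfl) (ih _ (by omega) m _ (by omega) rfl)

lemma flagExact_of_two_not_rel [DecidableEq X] [DecidableRel R] (hrefl : ∀ x, R x x)
    (hsymm : ∀ x y, R x y → R y x) (hS : S.card ≤ 2 * m + 2) {v w u : X} (hv : v ∈ S)
    (hw : w ∈ S) (hu : u ∈ S) (hwu : w ≠ u) (hvw : ¬ R v w) (hvu : ¬ R v u) :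
    FlagExact F R S (m + 1) := by
  have hwv : w ≠ v := by
    rintro rfl
    exact hvw (hrefl _)
  have huv : u ≠ v := by
    rintro rfl
    exact hvu (hrefl _)
  have h1 : (S.erase v).card + 1 = S.card := Finset.card_erase_add_one hv
  have h2 : ((S.erase v).erase w).card + 1 = (S.erase v).card :=
    Finset.card_erase_add_one (by simp [hw, hwv])
  have h3 : (((S.erase v).erase w).erase u).card + 1 = ((S.erase v).erase w).card :=
    Finset.card_erase_add_one (by simp [hu, huv, hwu.symm])
  have h4 : (S.filter (R v) ∩ S.erase v).card ≤ (((S.erase v).erase w).erase u).card := by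
    refine Finset.card_le_card fun x hx => ?_
    simp only [Finset.mem_inter, Finset.mem_filter, Finset.mem_erase] at hx ⊢
    refine ⟨?_, ?_, hx.2⟩ <;> rintro rfl
    · exact hvu hx.1.2
    · exact hvw hx.1.2
  exact flagExact_of_erase hrefl hsymm hv
    (flagExact_of_card_lt hrefl hsymm _ _ (by omega))
    (flagExact_of_card_lt hrefl hsymm _ _ (by omega))

/-- The homology in degree `m` of the flag chains on a cross-polytope with `2 * m` vertices
is one-dimensional. -/
lemma exists_generator_of_crossPolytope [DecidableEq X] [DecidableRel R] (hrefl : ∀ x, R x x)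
    (hsymm : ∀ x y, R x y → R y x) (m : ℕ) (S : Finset X) (hcard : S.card = 2 * m)
    (hS : ∀ x ∈ S, ∃ y ∈ S, ∀ z ∈ S, R x z ↔ z ≠ y) :
    ∃ z ∈ flagChains F R S m, listBoundary F X z = 0 ∧
      (∀ c ∈ flagChains F R S m, listBoundary F X c = 0 →
        ∃ a : F, ∃ d ∈ flagChains F R S (m + 1), c = a • z + listBoundary F X d) ∧
      ∀ a : F, ∀ d ∈ flagChains F R S (m + 1), a • z = listBoundary F X d → a = 0 := by
  induction m generalizing S with
  | zero =>
    obtain rfl : S = ∅ := Finset.card_eq_zero.1 (by simpa using hcard)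
    have h0 : flagTuples R ∅ 0 = {[]} := by
      ext l
      cases l <;> simp [flagTuples]
    refine ⟨single [] 1, ?_, ?_, ?_, ?_⟩
    · exact Finsupp.single_mem_supported F 1 (by simp [h0])
    · simp [listBoundary_single, listFaces]
    · intro c hc _
      refine ⟨c [], 0, Submodule.zero_mem _, ?_⟩
      rw [flagChains, h0] at hc
      ext l
      by_cases hl : l = []
      · simp [hl]
      · have : c l = 0 := (Finsupp.mem_supported' F c).1 hc l (by simpa using hl)
        simp [this, Ne.symm hl]
    · intro a d hd h
      rw [flagChains, flagTuples_empty_succ, Finsupp.supported_empty, Submodule.mem_bot] at hd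
      simpa [hd] using h
  | succ m ih =>
    obtain ⟨v, hv⟩ : S.Nonempty := Finset.card_pos.1 (by omega)
    obtain ⟨w, hw, hvw⟩ := hS v hv
    have hne : v ≠ w := (hvw v hv).1 (hrefl v)
    have hwv : ∀ z ∈ S, R w z ↔ z ≠ v := by
      obtain ⟨y, hy, h⟩ := hS w hw
      have : v = y := by
        by_contra hvy
        exact (hvw w hw).1 (hsymm _ _ ((h v hv).2 hvy)) rfl
      rwa [this]
    have hA : S.filter (R v) = S.erase w := by
      ext x
      simp only [Finset.mem_filter, Finset.mem_erase]
      exact ⟨fun h => ⟨(hvw x h.1).1 h.2, h.1⟩, fun h => ⟨h.2, (hvw x h.2).2 h.1⟩⟩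
    have hvA : v ∈ S.erase w := by simp [hv, hne]
    have hwB : w ∈ S.erase v := by simp [hw, hne.symm]
    have hvA' : ∀ x ∈ S.erase w, R v x := fun x hx =>
      (hvw x (Finset.mem_of_mem_erase hx)).2 (Finset.ne_of_mem_erase hx)
    have hwB' : ∀ x ∈ S.erase v, R w x := fun x hx =>
      (hwv x (Finset.mem_of_mem_erase hx)).2 (Finset.ne_of_mem_erase hx)
    set T := S.erase w ∩ S.erase v with hT
    have hTA : T ⊆ S.erase w := Finset.inter_subset_left
    have hTB : T ⊆ S.erase v := Finset.inter_subset_right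
    have hAS : S.erase w ⊆ S := Finset.erase_subset _ _
    have hBS : S.erase v ⊆ S := Finset.erase_subset _ _
    have hTcard : T.card = 2 * m := by
      have h1 : (S.erase v).card + 1 = S.card := Finset.card_erase_add_one hv
      have h2 : ((S.erase v).erase w).card + 1 = (S.erase v).card :=
        Finset.card_erase_add_one hwB
      have h3 : T = (S.erase v).erase w := by
        ext x
        simp only [hT, Finset.mem_inter, Finset.mem_erase]
        tauto
      rw [h3]
      omega
    have hTS : ∀ x ∈ T, ∃ y ∈ T, ∀ z ∈ T, R x z ↔ z ≠ y := by
      intro x hx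
      have hxA := hTA hx
      have hxB := hTB hx
      obtain ⟨y, hy, h⟩ := hS x (hAS hxA)
      refine ⟨y, ?_, fun z hz => h z (hAS (hTA hz))⟩
      have h1 := (h v hv).1 (hsymm _ _ (hvA' x hxA))
      have h2 := (h w hw).1 (hsymm _ _ (hwB' x hxB))
      simp [hT, hy, h1.symm, h2.symm]
    obtain ⟨z, hz, hz0, hgen, huniq⟩ := ih T hTcard hTS
    have hzv : listCone F v z ∈ flagChains F R (S.erase w) (m + 1) :=
      listCone_mem_flagChains hsymm hvA hvA' (flagChains_mono hTA hz)
    have hzw : listCone F w z ∈ flagChains F R (S.erase v) (m + 1) :=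
      listCone_mem_flagChains hsymm hwB hwB' (flagChains_mono hTB hz)
    have hbv : listBoundary F X (listCone F v z) = z := by
      simp [listBoundary_listCone, hz0]
    have hbw : listBoundary F X (listCone F w z) = z := by
      simp [listBoundary_listCone, hz0]
    refine ⟨listCone F v z - listCone F w z,
      Submodule.sub_mem _ (flagChains_mono hAS hzv) (flagChains_mono hBS hzw),
      by rw [map_sub, hbv, hbw, sub_self], ?_, ?_⟩
    · intro c hc h0
      obtain ⟨c₁, hc₁, c₂, hc₂, rfl⟩ := exists_flagChains_add_eq (R := R) v hc
      rw [hA] at hc₁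
      rw [map_add] at h0
      have hb : listBoundary F X c₁ ∈ flagChains F R T m := by
        refine mem_flagChains_inter (listBoundary_mem_flagChains hc₁) ?_
        rw [eq_neg_of_add_eq_zero_left h0]
        exact Submodule.neg_mem _ (listBoundary_mem_flagChains hc₂)
      obtain ⟨a, d, hd, had⟩ := hgen _ hb (listBoundary_listBoundary _)
      obtain ⟨e₁, he₁, heq₁⟩ := flagExact_of_cone (F := F) hsymm hvA hvA' (m + 1)
        (c₁ - a • listCone F v z - d)
        (Submodule.sub_mem _ (Submodule.sub_mem _ hc₁ (Submodule.smul_mem _ _ hzv))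
          (flagChains_mono hTA hd))
        (by rw [map_sub, map_sub, map_smul, hbv, had]; abel)
      obtain ⟨e₂, he₂, heq₂⟩ := flagExact_of_cone (F := F) hsymm hwB hwB' (m + 1)
        (c₂ + a • listCone F w z + d)
        (Submodule.add_mem _ (Submodule.add_mem _ hc₂ (Submodule.smul_mem _ _ hzw))
          (flagChains_mono hTB hd))
        (by
          rw [map_add, map_add, map_smul, hbw, eq_neg_of_add_eq_zero_right h0, had]
          abel)
      refine ⟨a, e₁ + e₂, Submodule.add_mem _ (flagChains_mono hAS he₁)
        (flagChains_mono hBS he₂), ?_⟩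
      rw [map_add, heq₁, heq₂, smul_sub]
      abel
    · intro a d hd h
      obtain ⟨d₁, hd₁, d₂, hd₂, rfl⟩ := exists_flagChains_add_eq (R := R) v hd
      rw [hA] at hd₁
      have he : a • listCone F v z - listBoundary F X d₁ =
          a • listCone F w z + listBoundary F X d₂ := by
        rw [smul_sub, map_add] at h
        rw [sub_eq_iff_eq_add] at h ⊢
        rw [h]
        abel
      refine huniq a (a • listCone F v z - listBoundary F X d₁)
        (mem_flagChains_inter ?_ ?_) ?_
      · exact Submodule.sub_mem _ (Submodule.smul_mem _ _ hzv) (listBoundary_mem_flagChains hd₁)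
      · rw [he]
        exact Submodule.add_mem _ (Submodule.smul_mem _ _ hzw) (listBoundary_mem_flagChains hd₂)
      · simp [hbv, listBoundary_listBoundary]

end FlagChains

/-! ### Comparison with the Vietoris–Rips chains -/

section Comparison

open Finsupp

variable {F : Type*} [Field F] {X : Type*}

lemma listFaces_ofFn (m : ℕ) (f : Fin (m + 1) → X) :
    listFaces F (List.ofFn f) = ∑ i : Fin (m + 1),
      ((-1 : F) ^ (i : ℕ)) • single (List.ofFn fun j => f (i.succAbove j)) (1 : F) := by
  induction m with
  | zero => simp [listFaces]
  | succ m ih =>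
    rw [List.ofFn_succ, listFaces, ih, map_sum, Fin.sum_univ_succ (n := m + 1)]
    simp [List.ofFn_succ, pow_succ, sub_eq_add_neg, Finset.sum_neg_distrib]

variable [MetricSpace X] {r : ℝ} {m : ℕ}

/-- A Vietoris–Rips chain as a chain of lists. -/
noncomputable def VRtoList (F : Type*) [Field F] (X : Type*) [MetricSpace X] (r : ℝ) (m : ℕ) :
    VRChain F X r m →ₗ[F] (List X →₀ F) :=
  Finsupp.lmapDomain F F fun f => List.ofFn f.1

lemma VRtoList_single (f : VRSimplex X r m) (a : F) :
    VRtoList F X r m (single f a) = single (List.ofFn f.1) a :=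
  Finsupp.mapDomain_single

lemma VRtoList_injective : Function.Injective (VRtoList F X r m) :=
  Finsupp.mapDomain_injective fun _ _ h => Subtype.ext (List.ofFn_injective h)

lemma VRtoList_boundary (c : VRChain F X r (m + 1)) :
    VRtoList F X r m (VRboundary F X r m c) = listBoundary F X (VRtoList F X r (m + 1) c) := by
  induction c using Finsupp.induction_linear with
  | zero => simp
  | add f g hf hg => simp [hf, hg]
  | single f a =>
    rw [VRtoList_single, listBoundary_single, listFaces_ofFn]
    simp [VRboundary, VRtoList_single]
    rfl

lemma range_VRtoList [Fintype X] :
    LinearMap.range (VRtoList F X r m) =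
      flagChains F (fun x y : X => dist x y ≤ r) Finset.univ m := by
  rw [VRtoList, LinearMap.range_eq_map, ← Finsupp.supported_univ, Finsupp.lmapDomain_supported,
    flagChains]
  congr 1
  ext l
  simp only [Set.image_univ, Set.mem_range, flagTuples, Set.mem_ofPred_eq, Finset.mem_univ,
    implies_true, true_and]
  constructor
  · rintro ⟨f, rfl⟩
    refine ⟨by simp, ?_⟩
    simp only [List.mem_ofFn]
    rintro _ ⟨i, rfl⟩ _ ⟨j, rfl⟩
    exact f.2 i j
  · rintro ⟨rfl, h⟩
    exact ⟨⟨l.get, fun i j => h _ (l.get_mem i) _ (l.get_mem j)⟩, List.ofFn_get l⟩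

lemma VRtoList_mem [Fintype X] (c : VRChain F X r m) :
    VRtoList F X r m c ∈ flagChains F (fun x y : X => dist x y ≤ r) Finset.univ m :=
  range_VRtoList (F := F) (X := X) ▸ LinearMap.mem_range_self _ c

lemma exists_VRtoList_eq [Fintype X] {c : List X →₀ F}
    (hc : c ∈ flagChains F (fun x y : X => dist x y ≤ r) Finset.univ m) :
    ∃ c', VRtoList F X r m c' = c := by
  rwa [← range_VRtoList] at hc

lemma VRboundary_exact_of_flagExact [Fintype X]
    (h : FlagExact F (fun x y : X => dist x y ≤ r) Finset.univ (m + 1))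
    (c : VRChain F X r (m + 1)) (hc : VRboundary F X r m c = 0) :
    ∃ d : VRChain F X r (m + 2), VRboundary F X r (m + 1) d = c := by
  obtain ⟨d, hd, hdc⟩ := h _ (VRtoList_mem c) (by rw [← VRtoList_boundary, hc, map_zero])
  obtain ⟨d, rfl⟩ := exists_VRtoList_eq hd
  exact ⟨d, VRtoList_injective (by rw [VRtoList_boundary, hdc])⟩

end Comparison

/-! ### The thresholds `tbX` and `tdX` -/

section Thresholds

variable {X : Type*} [MetricSpace X] [Fintype X]

lemma tbX_le_iff [Nontrivial X] {r : ℝ} :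
    tbX X ≤ r ↔ ∀ x y z : X, y ≠ z → dist x y ≤ r ∨ dist x z ≤ r := by
  have hfin (x : X) : {r : ℝ | ∃ y z : X, y ≠ z ∧ r = min (dist x y) (dist x z)}.Finite :=
    (Set.finite_range fun p : X × X => min (dist x p.1) (dist x p.2)).subset
      fun _ ⟨y, z, _, h⟩ => ⟨(y, z), h.symm⟩
  have hne (x : X) : {r : ℝ | ∃ y z : X, y ≠ z ∧ r = min (dist x y) (dist x z)}.Nonempty := by
    obtain ⟨y, z, h⟩ := exists_pair_ne X
    exact ⟨_, y, z, h, rfl⟩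
  rw [tbX, csSup_le_iff (Set.finite_range _).bddAbove (Set.range_nonempty _), Set.forall_mem_range]
  refine forall_congr' fun x => ?_
  rw [ptTb, csSup_le_iff (hfin x).bddAbove (hne x)]
  constructor
  · intro h y z hyz
    exact min_le_iff.1 (h _ ⟨y, z, hyz, rfl⟩)
  · rintro h _ ⟨y, z, hyz, rfl⟩
    exact min_le_iff.2 (h y z hyz)

lemma lt_tdX_iff [Nonempty X] {r : ℝ} : r < tdX X ↔ ∀ x : X, ∃ y, r < dist x y := by
  rw [tdX, (Set.finite_range _).lt_csInf_iff (Set.range_nonempty _), Set.forall_mem_range]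
  refine forall_congr' fun x => ?_
  rw [ptTd, lt_csSup_iff (Set.finite_range _).bddAbove (Set.range_nonempty _),
    Set.exists_range_iff]

end Thresholds

section Main

variable {F : Type*} [Field F] {X : Type*} [MetricSpace X] [Fintype X] {k : ℕ} {r : ℝ}

lemma VRboundary_exact_of_not_mem_Ico (hcard : Fintype.card X = 2 * k + 2)
    (h : ¬ (tbX X ≤ r ∧ r < tdX X)) (c : VRChain F X r (k + 1))
    (hc : VRboundary F X r k c = 0) :
    ∃ d : VRChain F X r (k + 2), VRboundary F X r (k + 1) d = c := by
  classical
  have : Nontrivial X := Fintype.one_lt_card_iff_nontrivial.1 (by omega)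
  rcases lt_or_ge r 0 with hr | hr
  · have : IsEmpty (VRSimplex X r (k + 1)) :=
      ⟨fun f => absurd (f.2 0 0) (by simpa using hr)⟩
    exact ⟨0, Subsingleton.elim _ _⟩
  refine VRboundary_exact_of_flagExact ?_ c hc
  have hrefl (x : X) : dist x x ≤ r := by simpa using hr
  have hsymm (x y : X) (h : dist x y ≤ r) : dist y x ≤ r := by rwa [dist_comm]
  rw [tbX_le_iff, lt_tdX_iff, not_and_or] at h
  push Not at h
  obtain ⟨x, y, z, hyz, hy, hz⟩ | ⟨x, hx⟩ := h
  · exact flagExact_of_two_not_rel hrefl hsymm (by rw [Finset.card_univ, hcard])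
      (Finset.mem_univ x) (Finset.mem_univ y) (Finset.mem_univ z) hyz hy.not_ge hz.not_ge
  · exact flagExact_of_cone hsymm (Finset.mem_univ x) (fun y _ => hx y) _

lemma exists_VRgenerator (hcard : Fintype.card X = 2 * k + 2)
    (htb : tbX X ≤ r) (htd : r < tdX X) :
    ∃ z : VRChain F X r (k + 1), VRboundary F X r k z = 0 ∧
      ∀ c : VRChain F X r (k + 1), VRboundary F X r k c = 0 →
        ∃! a : F, ∃ d : VRChain F X r (k + 2), c = a • z + VRboundary F X r (k + 1) d := by
  classical
  have : Nontrivial X := Fintype.one_lt_card_iff_nontrivial.1 (by omega)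
  rw [tbX_le_iff] at htb
  rw [lt_tdX_iff] at htd
  have hrefl (x : X) : dist x x ≤ r := by
    obtain ⟨y, hy⟩ := exists_ne x
    rw [dist_self]
    exact (htb x x y hy.symm).elim (by simp) dist_nonneg.trans
  have hsymm (x y : X) (h : dist x y ≤ r) : dist y x ≤ r := by rwa [dist_comm]
  obtain ⟨z, hz, hz0, hgen, huniq⟩ := exists_generator_of_crossPolytope (F := F)
    (R := fun x y : X => dist x y ≤ r) hrefl hsymm (k + 1) Finset.univ
    (by rw [Finset.card_univ, hcard]; ring) (by
      intro x _
      obtain ⟨y, hy⟩ := htd x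
      refine ⟨y, Finset.mem_univ y, fun z _ => ⟨?_, fun hzy => ?_⟩⟩
      · rintro hz rfl
        exact hy.not_ge hz
      · exact (htb x z y hzy).resolve_right hy.not_ge)
  obtain ⟨z, rfl⟩ := exists_VRtoList_eq hz
  refine ⟨z, VRtoList_injective (by rw [VRtoList_boundary, hz0, map_zero]), fun c hc => ?_⟩
  obtain ⟨a, d, hd, had⟩ := hgen _ (VRtoList_mem c) (by rw [← VRtoList_boundary, hc, map_zero])
  obtain ⟨d, rfl⟩ := exists_VRtoList_eq hd
  have hcd : c = a • z + VRboundary F X r (k + 1) d :=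
    VRtoList_injective (by rw [had, map_add, map_smul, VRtoList_boundary])
  refine ⟨a, ⟨d, hcd⟩, ?_⟩
  rintro b ⟨e, hce⟩
  have key : (b - a) • z = VRboundary F X r (k + 1) (d - e) := by
    rw [sub_smul, map_sub, sub_eq_sub_iff_add_eq_add, ← hce, hcd]
    abel
  refine sub_eq_zero.1 (huniq (b - a) _ (VRtoList_mem (d - e)) ?_)
  rw [← VRtoList_boundary, ← key, map_smul]

end Main

/-- For a metric space `X` with `n = 2k + 2` points:
if `t_b(X) < t_d(X)` then the reduced homology `H̃_k(VR_r(X); F)` is isomorphic to `F`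
for `t_b(X) ≤ r < t_d(X)` (there is a cycle `z` such that every cycle is, for a unique
scalar `a`, equal to `a • z` plus a boundary) and vanishes for all other `r`;
if `t_b(X) ≥ t_d(X)` then `H̃_k(VR_r(X); F) = 0` for all `r`. -/
theorem vietorisRips_reduced_homology_characterization (F : Type*) [Field F]
    (X : Type*) [MetricSpace X] [Fintype X] (k : ℕ)
    (hcard : Fintype.card X = 2 * k + 2) :
    (tbX X < tdX X →
      (∀ r : ℝ, tbX X ≤ r → r < tdX X →
        ∃ z : VRChain F X r (k + 1), VRboundary F X r k z = 0 ∧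
          ∀ c : VRChain F X r (k + 1), VRboundary F X r k c = 0 →
            ∃! a : F, ∃ d : VRChain F X r (k + 2),
              c = a • z + VRboundary F X r (k + 1) d) ∧
      (∀ r : ℝ, r < tbX X ∨ tdX X ≤ r →
        ∀ c : VRChain F X r (k + 1), VRboundary F X r k c = 0 →
          ∃ d : VRChain F X r (k + 2), VRboundary F X r (k + 1) d = c)) ∧
    (tdX X ≤ tbX X →
      ∀ r : ℝ, ∀ c : VRChain F X r (k + 1), VRboundary F X r k c = 0 →
        ∃ d : VRChain F X r (k + 2), VRboundary F X r (k + 1) d = c) := by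
  refine ⟨fun _ => ⟨fun r => exists_VRgenerator hcard, fun r hr => ?_⟩, fun h r => ?_⟩
  · exact VRboundary_exact_of_not_mem_Ico hcard fun h =>
      hr.elim h.1.not_gt h.2.not_ge
  · exact VRboundary_exact_of_not_mem_Ico hcard fun hr =>
      (hr.1.trans_lt hr.2).not_ge h
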